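/- arXiv:2407.06276 — 2 statements merged into one kernel-verified Lean document; each statement's English description precedes it below -/
import Mathlib

section
/- Let V be a complex vector space and let J, L, S : Fin 3 → End(V) with J m = L m + S m for every m. Assume: (1) [J m, J n] = i·Σ_p ε(m,n,p)·(J p) for all m,n; (2) the vector-operator conditions [L m, J n] = i·Σ_p ε(m,n,p)·(L p) and [S m, J n] = i·Σ_p ε(m,n,p)·(S p) hold for all m,n; (3) there are complex structure constants ν, τ : Fin 3 → Fin 3 → Fin 3 → ℂ with [L m, L n] = i·Σ_p ν(m,n,p)·(L p) and [S m, S n] = i·Σ_p τ(m,n,p)·(S p) for all m,n; (4) the six operators L 0, L 1, L 2, S 0, S 1, S 2 are linearly independent over ℂ. Then [L m, L n] = i·Σ_p ε(m,n,p)·(L p) and [S m, S n] = i·Σ_p ε(m,n,p)·(S p) for all m,n; that is, both L and S satisfy the so(3) commutation relations. (No-Go Theorem 3 of the paper, case of linearly independent components: if the total angular momentum splits into two vector operators each generating a Lie algebra, both Lie algebras must be so(3).) -/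
/-- The totally antisymmetric Levi-Civita symbol on three indices, with `ε 0 1 2 = 1`. -/
noncomputable def levicivita (m n p : Fin 3) : ℂ :=
  (((m.val : ℂ) - n.val) * ((n.val : ℂ) - p.val) * ((p.val : ℂ) - m.val)) / 2

/-- No-Go Theorem 3 of the paper (case of linearly independent components): if the total
angular momentum `J = L + S` splits into two vector operators `L` and `S`, each of which
closes onto itself with some structure constants (`ν` and `τ`), and the six components
`L 0, L 1, L 2, S 0, S 1, S 2` are linearly independent, then both `L` and `S` in fact
satisfy the `so(3)` commutation relations. -/
theorem nogo3_linearIndependent {V : Type*} [AddCommGroup V] [Module ℂ V]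
    (J L S : Fin 3 → Module.End ℂ V)
    (ν τ : Fin 3 → Fin 3 → Fin 3 → ℂ)
    (hJLS : ∀ m, J m = L m + S m)
    (hJJ : ∀ m n, J m * J n - J n * J m = ∑ p, (Complex.I * levicivita m n p) • J p)
    (hLJ : ∀ m n, L m * J n - J n * L m = ∑ p, (Complex.I * levicivita m n p) • L p)
    (hSJ : ∀ m n, S m * J n - J n * S m = ∑ p, (Complex.I * levicivita m n p) • S p)
    (hLL : ∀ m n, L m * L n - L n * L m = ∑ p, (Complex.I * ν m n p) • L p)
    (hSS : ∀ m n, S m * S n - S n * S m = ∑ p, (Complex.I * τ m n p) • S p)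
    (hind : LinearIndependent ℂ (Sum.elim L S)) :
    (∀ m n, L m * L n - L n * L m = ∑ p, (Complex.I * levicivita m n p) • L p) ∧
    (∀ m n, S m * S n - S n * S m = ∑ p, (Complex.I * levicivita m n p) • S p) := by
  obtain ⟨-, -, hdisj⟩ := linearIndependent_sum.mp hind
  rw [Submodule.disjoint_def] at hdisj
  have memL : ∀ c : Fin 3 → ℂ, ∑ p, c p • L p ∈
      Submodule.span ℂ (Set.range (Sum.elim L S ∘ Sum.inl)) := fun c =>
    Submodule.sum_mem _ fun p _ => Submodule.smul_mem _ _ (Submodule.subset_span ⟨p, rfl⟩)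
  have memS : ∀ c : Fin 3 → ℂ, ∑ p, c p • S p ∈
      Submodule.span ℂ (Set.range (Sum.elim L S ∘ Sum.inr)) := fun c =>
    Submodule.sum_mem _ fun p _ => Submodule.smul_mem _ _ (Submodule.subset_span ⟨p, rfl⟩)
  have key : ∀ m n, L m * S n - S n * L m = 0 := by
    intro m n
    apply hdisj
    · have h : L m * S n - S n * L m =
          (L m * J n - J n * L m) - (L m * L n - L n * L m) := by
        rw [hJLS n]; noncomm_ring
      rw [h, hLJ, hLL]
      exact Submodule.sub_mem _ (memL _) (memL _)
    · have h : L m * S n - S n * L m =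
          -(S n * J m - J m * S n) - (S m * S n - S n * S m) := by
        rw [hJLS m]; noncomm_ring
      rw [h, hSJ, hSS]
      exact Submodule.sub_mem _ (Submodule.neg_mem _ (memS _)) (memS _)
  refine ⟨fun m n => ?_, fun m n => ?_⟩
  · rw [← hLJ m n, ← sub_eq_zero, ← neg_eq_zero, ← key m n, hJLS n]
    noncomm_ring
  · rw [← hSJ m n, ← sub_eq_zero, ← key n m, hJLS n]
    noncomm_ring
end

section
/- Let V be a complex vector space, L : Fin 3 → End(V), and c : Fin 3 → ℂ. Define S m = (c m) • (L m) and J m = L m + S m = (1 + c m) • (L m). Assume: (1) L m ≠ 0 and c m ≠ −1 for every m; (2) [J m, J n] = i·Σ_p ε(m,n,p)·(J p) for all m,n; (3) [L m, J n] = i·Σ_p ε(m,n,p)·(L p) for all m,n. Then all the constants c m are equal to a common value c, and the rescaled operators L' m := (1 + c) • (L m) satisfy the so(3) commutation relations [L' m, L' n] = i·Σ_p ε(m,n,p)·(L' p) for all m,n. (No-Go Theorem 3 of the paper, case where S is a componentwise multiple of L: after rescaling, L generates so(3).) -/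
/-- No-Go Theorem 3 of the paper (case where `S` is a componentwise multiple of `L`):
if `S m = c m • L m`, `J m = L m + S m = (1 + c m) • L m`, with `L m ≠ 0`, `c m ≠ -1`,
`J` satisfying the `so(3)` relations and `L` being a vector operator, then all the
constants `c m` coincide, and after rescaling by `(1 + c)` the operators `L` satisfy
the `so(3)` commutation relations. -/
theorem nogo3_proportional {V : Type*} [AddCommGroup V] [Module ℂ V]
    (L S J : Fin 3 → Module.End ℂ V) (c : Fin 3 → ℂ)
    (hS : ∀ m, S m = c m • L m)
    (hJ : ∀ m, J m = L m + S m)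
    (hL0 : ∀ m, L m ≠ 0)
    (hc : ∀ m, c m ≠ -1)
    (hJJ : ∀ m n, J m * J n - J n * J m = ∑ p, (Complex.I * levicivita m n p) • J p)
    (hLJ : ∀ m n, L m * J n - J n * L m = ∑ p, (Complex.I * levicivita m n p) • L p) :
    ∃ c₀ : ℂ, (∀ m, c m = c₀) ∧
      ∀ m n, ((1 + c₀) • L m) * ((1 + c₀) • L n) - ((1 + c₀) • L n) * ((1 + c₀) • L m)
        = ∑ p, (Complex.I * levicivita m n p) • ((1 + c₀) • L p) := by
  have hJ' : ∀ m, J m = (1 + c m) • L m := fun m => by rw [hJ, hS, add_smul, one_smul]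
  have key : ∀ m n, ∑ p, (Complex.I * levicivita m n p) • J p
      = (1 + c m) • ∑ p, (Complex.I * levicivita m n p) • L p := by
    intro m n
    rw [← hJJ, ← hLJ, smul_sub, hJ' m, smul_mul_assoc, mul_smul_comm]
  have h1 : c 2 = c 0 := by
    have h := key 0 1
    simp only [hJ', Fin.sum_univ_three, levicivita] at h
    norm_num [smul_smul] at h
    rw [← sub_eq_zero, ← sub_smul, smul_eq_zero] at h
    rcases h with h | h
    · have h2 : Complex.I * (c 2 - c 0) = 0 := by linear_combination h
      rcases mul_eq_zero.mp h2 with h3 | h3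
      · exact absurd h3 Complex.I_ne_zero
      · exact sub_eq_zero.mp h3
    · exact absurd h (hL0 2)
  have h2 : c 0 = c 1 := by
    have h := key 1 2
    simp only [hJ', Fin.sum_univ_three, levicivita] at h
    norm_num [smul_smul] at h
    rw [← sub_eq_zero, ← sub_smul, smul_eq_zero] at h
    rcases h with h | h
    · have h2 : Complex.I * (c 0 - c 1) = 0 := by linear_combination h
      rcases mul_eq_zero.mp h2 with h3 | h3
      · exact absurd h3 Complex.I_ne_zero
      · exact sub_eq_zero.mp h3
    · exact absurd h (hL0 0)
  have hall : ∀ m, c m = c 0 := by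
    intro m
    fin_cases m
    · rfl
    · exact h2.symm
    · exact h1
  refine ⟨c 0, hall, ?_⟩
  have hJ0 : ∀ m, (1 + c 0) • L m = J m := fun m => by rw [hJ' m, hall m]
  intro m n
  simp only [hJ0]
  exact hJJ m n
end
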